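/- For a weakly C(4) finite monoid presentation ⟨A | R⟩: suppose u = X·Y·u′ where XY is a clean overlap prefix of u (XYZ a relation word with maximal piece prefix X, middle word Y, maximal piece suffix Z), and let p be a piece. Then u ≡ v and p is a possible prefix of u if and only if one of the following mutually exclusive conditions holds: (1′) u = XYZ·u″, v = XYZ·v″, Z̄·u″ ≡ Z̄·v″ for some complement Z̄ of Z, and p is a prefix of some complement of X; (2′) u = XY·u′, v = XY·v′, Z fails to be a prefix of at least one of u′ and v′, u′ ≡ v′, and either p is a prefix of X, or p is a prefix of some complement of X and Z is a possible prefix of u′; (3′) u = XYZ·u″, v = X̄·Ȳ·Z̄·v″ for some uniquely determined proper complement X̄ȲZ̄ of XYZ, Ẑ·u″ ≡ Ẑ·v″ for some complement Ẑ of Z, and p is a prefix of some complement of X; (4′) u = XY·u′, v = X̄·Ȳ·Z̄·v″ for some uniquely determined proper complement X̄ȲZ̄ of XYZ, Z is not a prefix of u′, u′ ≡ Z·v″, and p is a prefix of some complement of X; (5′) u = XYZ·u″, v = X̄·Ȳ·v′ for some uniquely determined proper complement X̄ȲZ̄ of XYZ, Z̄ is not a prefix of v′, Z̄·u″ ≡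 v′, and p is a prefix of some complement of X; (6′) u = XY·u′, v = X̄·Ȳ·v′ for some uniquely determined proper complement X̄ȲZ̄ of XYZ, Z is not a prefix of u′, Z̄ is not a prefix of v′, and writing z for the maximal common suffix of Z and Z̄ with Z = z₁·z and Z̄ = z₂·z, we have u′ = z₁·u″, v′ = z₂·v″, u″ ≡ v″, z is nonempty, z is a possible prefix of u″, and p is a prefix of some complement of X. -/

import Mathlib

open List

/-- A *relation word* is a word occurring as one side of some relation in `R`. -/
def RelWord {A : Type*} (R : Finset (List A × List A)) (w : List A) : Prop :=
  ∃ p ∈ R, w = p.1 ∨ w = p.2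

/-- One elementary rewriting step using a defining relation (in either direction). -/
def OneStep {A : Type*} (R : Finset (List A × List A)) (u v : List A) : Prop :=
  ∃ l r x y, ((x, y) ∈ R ∨ (y, x) ∈ R) ∧ u = l ++ x ++ r ∧ v = l ++ y ++ r

/-- `u ≡ v`: the congruence on the free monoid `A*` generated by the relations `R`. -/
def MEquiv {A : Type*} (R : Finset (List A × List A)) : List A → List A → Prop :=
  Relation.ReflTransGen (OneStep R)

/-- A *piece*: a word occurring as a factor of two distinct relation words, or in two
different (possibly overlapping) positions within one relation word.  The empty word
is a piece. -/
def Piece {A : Type*} (R : Finset (List A × List A)) (p : List A) : Prop :=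
  p = [] ∨ ∃ r₁ r₂ a₁ b₁ a₂ b₂, RelWord R r₁ ∧ RelWord R r₂ ∧
    r₁ = a₁ ++ p ++ b₁ ∧ r₂ = a₂ ++ p ++ b₂ ∧ (r₁ ≠ r₂ ∨ a₁ ≠ a₂)

/-- Weakly `C(n)`: no relation word is a product of strictly fewer than `n` pieces. -/
def WeaklyC {A : Type*} (R : Finset (List A × List A)) (n : ℕ) : Prop :=
  ∀ w, RelWord R w → ∀ L : List (List A), (∀ p ∈ L, Piece R p) → w = L.flatten →
    n ≤ L.length

/-- `X` is the maximal (longest) prefix of `r` which is a piece. -/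
def MaxPiecePrefix {A : Type*} (R : Finset (List A × List A)) (r X : List A) : Prop :=
  X <+: r ∧ Piece R X ∧ ∀ p, p <+: r → Piece R p → p.length ≤ X.length

/-- `Z` is the maximal (longest) suffix of `r` which is a piece. -/
def MaxPieceSuffix {A : Type*} (R : Finset (List A × List A)) (r Z : List A) : Prop :=
  Z <:+ r ∧ Piece R Z ∧ ∀ s, s <:+ r → Piece R s → s.length ≤ Z.length

/-- `X ++ Y ++ Z` is a relation word with maximal piece prefix `X`, middle word `Y`
and maximal piece suffix `Z`. -/
def RelDecomp {A : Type*} (R : Finset (List A × List A)) (X Y Z : List A) : Prop :=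
  RelWord R (X ++ Y ++ Z) ∧ MaxPiecePrefix R (X ++ Y ++ Z) X ∧
    MaxPieceSuffix R (X ++ Y ++ Z) Z

/-- `q` is a relation prefix of `u`: a prefix of the form `a ++ X ++ Y` where `X`, `Y`
are the maximal piece prefix and middle word of some relation word `X ++ Y ++ Z`. -/
def RelPrefix {A : Type*} (R : Finset (List A × List A)) (u q : List A) : Prop :=
  q <+: u ∧ ∃ a X Y Z, q = a ++ X ++ Y ∧ RelDecomp R X Y Z

/-- `a ++ X ++ Y` is an overlap prefix of `u`, with final maximal piece prefix `X` and
middle word `Y`, i.e. it admits a factorisation `b X₁ Y₁' ⋯ X_{n-1} Y_{n-1}' X_n Y_n`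
with `X = X_n`, `Y = Y_n`, no factor `X₀ Y₀` beginning strictly before the end of `b`,
each `X_i Y_i Z_i` a relation word factored into maximal piece prefix, middle word and
maximal piece suffix, and each `Y_i'` (`i < n`) a proper non-empty prefix of `Y_i`. -/
def OPrefix {A : Type*} (R : Finset (List A × List A)) (u a X Y : List A) : Prop :=
  (a ++ X ++ Y) <+: u ∧
  ∃ (b : List A) (n : ℕ) (Xs Ys Zs Ys' : ℕ → List A),
    1 ≤ n ∧ Xs (n - 1) = X ∧ Ys (n - 1) = Y ∧
    a = b ++ ((List.range (n - 1)).map fun i => Xs i ++ Ys' i).flatten ∧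
    (∀ i < n, RelDecomp R (Xs i) (Ys i) (Zs i)) ∧
    (∀ i < n - 1, Ys' i ≠ [] ∧ Ys' i <+: Ys i ∧ Ys' i ≠ Ys i) ∧
    ¬ ∃ c d X₀ Y₀ Z₀, RelDecomp R X₀ Y₀ Z₀ ∧
        a ++ X ++ Y = c ++ X₀ ++ Y₀ ++ d ∧ c.length < b.length

/-- The relation prefix `a ++ X ++ Y` of `u` is *clean*: `u` has no prefix
`a ++ X ++ Y₀ ++ X₁ ++ Y₁` with `Y₀` a proper non-empty prefix of `Y` and `X₁`, `Y₁`
the maximal piece prefix and middle word of some relation word. -/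
def CleanAt {A : Type*} (R : Finset (List A × List A)) (u a X Y : List A) : Prop :=
  ¬ ∃ Y₀ X₁ Y₁ Z₁, RelDecomp R X₁ Y₁ Z₁ ∧ Y₀ ≠ [] ∧ Y₀ <+: Y ∧ Y₀ ≠ Y ∧
      (a ++ X ++ Y₀ ++ X₁ ++ Y₁) <+: u

/-- `a ++ X ++ Y` is a clean overlap prefix of `u`, where `X ++ Y ++ Z` is a relation
word with maximal piece prefix `X`, middle word `Y` and maximal piece suffix `Z`. -/
def CleanOverlapPrefix {A : Type*} (R : Finset (List A × List A))
    (u a X Y Z : List A) : Prop :=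
  RelDecomp R X Y Z ∧ OPrefix R u a X Y ∧ CleanAt R u a X Y

/-- `r'` is a complement of the relation word `r`: there is a chain of relation words
from `r` to `r'` each consecutive pair of which forms a relation (in some order). -/
def RelComplement {A : Type*} (R : Finset (List A × List A)) (r r' : List A) : Prop :=
  RelWord R r ∧ Relation.ReflTransGen (fun s t => (s, t) ∈ R ∨ (t, s) ∈ R) r r'

/-- `u` is `p`-active: `p ++ u` has a relation prefix `a ++ X ++ Y` with `|a| < |p|`. -/
def PActive {A : Type*} (R : Finset (List A × List A)) (p u : List A) : Prop :=
  ∃ a X Y Z, RelDecomp R X Y Z ∧ (a ++ X ++ Y) <+: (p ++ u) ∧ a.length < p.length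

/-- `p` is a possible prefix of `u`: `p ++ w ≡ u` for some word `w`. -/
def PossPrefix {A : Type*} (R : Finset (List A × List A)) (p u : List A) : Prop :=
  ∃ w, MEquiv R (p ++ w) u

/-- `Z'` is a complement of `Z` (relative to the relation word `X ++ Y ++ Z`). -/
def ZComp {A : Type*} (R : Finset (List A × List A)) (X Y Z Z' : List A) : Prop :=
  ∃ X' Y', RelComplement R (X ++ Y ++ Z) (X' ++ Y' ++ Z') ∧ RelDecomp R X' Y' Z'

/-- `X'` is a complement of `X` (relative to the relation word `X ++ Y ++ Z`). -/
def XComp {A : Type*} (R : Finset (List A × List A)) (X Y Z X' : List A) : Prop :=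
  ∃ Y' Z', RelComplement R (X ++ Y ++ Z) (X' ++ Y' ++ Z') ∧ RelDecomp R X' Y' Z'

/-- `p` is a prefix of some complement of `X`. -/
def PrefXComp {A : Type*} (R : Finset (List A × List A)) (X Y Z p : List A) : Prop :=
  ∃ X', XComp R X Y Z X' ∧ p <+: X'

/-- `X' ++ Y' ++ Z'` is a *proper* complement of the relation word `r`. -/
def ProperComp {A : Type*} (R : Finset (List A × List A)) (r X' Y' Z' : List A) :
    Prop :=
  RelComplement R r (X' ++ Y' ++ Z') ∧ RelDecomp R X' Y' Z' ∧ X' ++ Y' ++ Z' ≠ r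

/-- `X' ++ Y' ++ Z'` is the *uniquely determined* proper complement of `r` whose
prefix `X' ++ Y'` is a prefix of `v`. -/
def UniqueComp {A : Type*} (R : Finset (List A × List A)) (r v X' Y' Z' : List A) :
    Prop :=
  ∀ X'' Y'' Z'', ProperComp R r X'' Y'' Z'' → (X'' ++ Y'') <+: v →
    X'' = X' ∧ Y'' = Y' ∧ Z'' = Z'

/-- Condition (1′). -/
def Cond1' {A : Type*} (R : Finset (List A × List A)) (X Y Z u' v p : List A) :
    Prop :=
  (∃ u'' v'', u' = Z ++ u'' ∧ v = X ++ Y ++ Z ++ v'' ∧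
    ∃ Z', ZComp R X Y Z Z' ∧ MEquiv R (Z' ++ u'') (Z' ++ v'')) ∧
  PrefXComp R X Y Z p

/-- Condition (2′). -/
def Cond2' {A : Type*} (R : Finset (List A × List A)) (X Y Z u' v p : List A) :
    Prop :=
  (∃ v', v = X ++ Y ++ v' ∧ (¬ Z <+: u' ∨ ¬ Z <+: v') ∧ MEquiv R u' v') ∧
  (p <+: X ∨ (PrefXComp R X Y Z p ∧ PossPrefix R Z u'))

/-- Condition (3′). -/
def Cond3' {A : Type*} (R : Finset (List A × List A)) (X Y Z u' v p : List A) :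
    Prop :=
  (∃ X' Y' Z' u'' v'', u' = Z ++ u'' ∧ ProperComp R (X ++ Y ++ Z) X' Y' Z' ∧
    v = X' ++ Y' ++ Z' ++ v'' ∧ UniqueComp R (X ++ Y ++ Z) v X' Y' Z' ∧
    ∃ Zh, ZComp R X Y Z Zh ∧ MEquiv R (Zh ++ u'') (Zh ++ v'')) ∧
  PrefXComp R X Y Z p

/-- Condition (4′). -/
def Cond4' {A : Type*} (R : Finset (List A × List A)) (X Y Z u' v p : List A) :
    Prop :=
  (∃ X' Y' Z' v'', ProperComp R (X ++ Y ++ Z) X' Y' Z' ∧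
    v = X' ++ Y' ++ Z' ++ v'' ∧ UniqueComp R (X ++ Y ++ Z) v X' Y' Z' ∧
    ¬ Z <+: u' ∧ MEquiv R u' (Z ++ v'')) ∧
  PrefXComp R X Y Z p

/-- Condition (5′). -/
def Cond5' {A : Type*} (R : Finset (List A × List A)) (X Y Z u' v p : List A) :
    Prop :=
  (∃ X' Y' Z' u'' v', u' = Z ++ u'' ∧ ProperComp R (X ++ Y ++ Z) X' Y' Z' ∧
    v = X' ++ Y' ++ v' ∧ UniqueComp R (X ++ Y ++ Z) v X' Y' Z' ∧
    ¬ Z' <+: v' ∧ MEquiv R (Z' ++ u'') v') ∧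
  PrefXComp R X Y Z p

/-- Condition (6′). -/
def Cond6' {A : Type*} (R : Finset (List A × List A)) (X Y Z u' v p : List A) :
    Prop :=
  (∃ X' Y' Z' v', ProperComp R (X ++ Y ++ Z) X' Y' Z' ∧ v = X' ++ Y' ++ v' ∧
    UniqueComp R (X ++ Y ++ Z) v X' Y' Z' ∧ ¬ Z <+: u' ∧ ¬ Z' <+: v' ∧
    ∃ z z₁ z₂ u'' v'', Z = z₁ ++ z ∧ Z' = z₂ ++ z ∧
      (∀ w, w <:+ Z → w <:+ Z' → w.length ≤ z.length) ∧
      u' = z₁ ++ u'' ∧ v' = z₂ ++ v'' ∧ MEquiv R u'' v'' ∧ z ≠ [] ∧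
      PossPrefix R z u'') ∧
  PrefXComp R X Y Z p

section SmallOverlap

variable {A : Type*} {R : Finset (List A × List A)}

theorem OneStep.symm {u v : List A} (h : OneStep R u v) : OneStep R v u := by
  obtain ⟨l, r, x, y, hxy, hu, hv⟩ := h
  exact ⟨l, r, y, x, hxy.symm, hv, hu⟩

theorem OneStep.append_left {u v : List A} (p : List A) (h : OneStep R u v) :
    OneStep R (p ++ u) (p ++ v) := by
  obtain ⟨l, r, x, y, hxy, rfl, rfl⟩ := h
  exact ⟨p ++ l, r, x, y, hxy, by simp, by simp⟩

theorem OneStep.append_right {u v : List A} (p : List A) (h : OneStep R u v) :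
    OneStep R (u ++ p) (v ++ p) := by
  obtain ⟨l, r, x, y, hxy, rfl, rfl⟩ := h
  exact ⟨l, r ++ p, x, y, hxy, by simp, by simp⟩

namespace MEquiv

theorem refl (u : List A) : MEquiv R u u := Relation.ReflTransGen.refl

theorem trans {u v w : List A} (h : MEquiv R u v) (h' : MEquiv R v w) : MEquiv R u w :=
  Relation.ReflTransGen.trans h h'

theorem symm {u v : List A} (h : MEquiv R u v) : MEquiv R v u :=
  have : Std.Symm (OneStep R) := ⟨fun _ _ => OneStep.symm⟩
  Relation.ReflTransGen.stdSymm.symm _ _ h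

theorem append_left {u v : List A} (p : List A) (h : MEquiv R u v) :
    MEquiv R (p ++ u) (p ++ v) :=
  Relation.ReflTransGen.lift (p ++ ·) (fun _ _ => OneStep.append_left p) _ _ h

theorem append_right {u v : List A} (p : List A) (h : MEquiv R u v) :
    MEquiv R (u ++ p) (v ++ p) :=
  Relation.ReflTransGen.lift (· ++ p) (fun _ _ => OneStep.append_right p) _ _ h

end MEquiv

/-- `v` is obtained from `u` by exactly `n` elementary rewriting steps. -/
def StepsN (R : Finset (List A × List A)) : ℕ → List A → List A → Prop
  | 0, u, v => u = v
  | n + 1, u, v => ∃ w, StepsN R n u w ∧ OneStep R w v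

namespace StepsN

theorem append_left {n : ℕ} {u v : List A} (p : List A) (h : StepsN R n u v) :
    StepsN R n (p ++ u) (p ++ v) := by
  induction n generalizing v with
  | zero => exact congrArg (p ++ ·) h
  | succ n ih =>
    obtain ⟨w, hw, hs⟩ := h
    exact ⟨p ++ w, ih hw, hs.append_left p⟩

theorem head {n : ℕ} {u v w : List A} (h : OneStep R u v) (h' : StepsN R n v w) :
    StepsN R (n + 1) u w := by
  induction n generalizing w with
  | zero => exact ⟨u, rfl, h' ▸ h⟩
  | succ n ih =>
    obtain ⟨t, ht, hs⟩ := h'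
    exact ⟨t, ih ht, hs⟩

theorem symm {n : ℕ} {u v : List A} (h : StepsN R n u v) : StepsN R n v u := by
  induction n generalizing v with
  | zero => exact Eq.symm h
  | succ n ih =>
    obtain ⟨w, hw, hs⟩ := h
    exact head hs.symm (ih hw)

theorem exists_of_mequiv {u v : List A} (h : MEquiv R u v) : ∃ n, StepsN R n u v := by
  induction h with
  | refl => exact ⟨0, rfl⟩
  | tail _ hs ih =>
    obtain ⟨n, hn⟩ := ih
    exact ⟨n + 1, _, hn, hs⟩

end StepsN

theorem Piece.of_isInfix {p q : List A} (hp : Piece R p) (h : q <:+: p) : Piece R q := by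
  obtain ⟨s, t, rfl⟩ := h
  rcases hp with hp | ⟨r₁, r₂, a₁, b₁, a₂, b₂, h₁, h₂, e₁, e₂, hne⟩
  · left
    simp_all
  · refine Or.inr ⟨r₁, r₂, a₁ ++ s, t ++ b₁, a₂ ++ s, t ++ b₂, h₁, h₂, by simp [e₁],
      by simp [e₂], hne.imp_right fun h h' => h (List.append_cancel_right h')⟩

theorem relWord_left {x y : List A} (h : (x, y) ∈ R ∨ (y, x) ∈ R) : RelWord R x := by
  rcases h with h | h
  · exact ⟨_, h, Or.inl rfl⟩
  · exact ⟨_, h, Or.inr rfl⟩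

theorem relWord_right {x y : List A} (h : (x, y) ∈ R ∨ (y, x) ∈ R) : RelWord R y :=
  relWord_left h.symm

theorem WeaklyC.ne_append (hC : WeaklyC R 4) {p q : List A} (hp : Piece R p)
    (hq : Piece R q) : ¬ RelWord R (p ++ q) := by
  intro h
  have := hC _ h [p, q] (by simp [hp, hq]) (by simp)
  simp at this

theorem WeaklyC.not_piece (hC : WeaklyC R 4) {r : List A} (h : RelWord R r) :
    ¬ Piece R r := by
  intro hr
  exact hC.ne_append hr (Or.inl rfl) (by simpa using h)

theorem exists_maxPiecePrefix (R : Finset (List A × List A)) (r : List A) :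
    ∃ X, MaxPiecePrefix R r X := by
  classical
  let P : ℕ → Prop := fun n => ∃ p, p <+: r ∧ Piece R p ∧ p.length = n
  have h0 : P 0 := ⟨[], ⟨r, rfl⟩, Or.inl rfl, rfl⟩
  obtain ⟨X, hX, hXp, hXl⟩ := Nat.findGreatest_spec (Nat.zero_le r.length) h0
  refine ⟨X, hX, hXp, fun p hp hpp => ?_⟩
  rw [hXl]
  exact Nat.le_findGreatest hp.length_le ⟨p, hp, hpp, rfl⟩

theorem exists_maxPieceSuffix (R : Finset (List A × List A)) (r : List A) :
    ∃ Z, MaxPieceSuffix R r Z := by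
  classical
  let P : ℕ → Prop := fun n => ∃ p, p <:+ r ∧ Piece R p ∧ p.length = n
  have h0 : P 0 := ⟨[], List.nil_suffix, Or.inl rfl, rfl⟩
  obtain ⟨Z, hZ, hZp, hZl⟩ := Nat.findGreatest_spec (Nat.zero_le r.length) h0
  refine ⟨Z, hZ, hZp, fun p hp hpp => ?_⟩
  rw [hZl]
  exact Nat.le_findGreatest hp.length_le ⟨p, hp, hpp, rfl⟩

theorem WeaklyC.exists_relDecomp (hC : WeaklyC R 4) {r : List A} (h : RelWord R r) :
    ∃ X Y Z, r = X ++ Y ++ Z ∧ RelDecomp R X Y Z := by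
  obtain ⟨X, hX⟩ := exists_maxPiecePrefix R r
  obtain ⟨Z, hZ⟩ := exists_maxPieceSuffix R r
  obtain ⟨s, hs⟩ := hX.1
  obtain ⟨t, ht⟩ := hZ.1
  have hst : X ++ s = t ++ Z := hs.trans ht.symm
  rcases List.append_eq_append_iff.1 hst with ⟨Y, h₁, h₂⟩ | ⟨Y, h₁, h₂⟩
  · have e : r = X ++ Y ++ Z := by rw [← hs, h₂]; simp
    subst e
    exact ⟨X, Y, Z, rfl, h, hX, hZ⟩
  · exact absurd (hs ▸ h) (hC.ne_append hX.2.1 (hZ.2.1.of_isInfix ⟨Y, [], by simp [h₂]⟩))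

namespace RelDecomp

variable {X Y Z X₁ Y₁ Z₁ : List A}

theorem middle_ne_nil (hC : WeaklyC R 4) (h : RelDecomp R X Y Z) : Y ≠ [] := by
  rintro rfl
  exact hC.ne_append h.2.1.2.1 h.2.2.2.1 (by simpa using h.1)

theorem not_piece_head (hC : WeaklyC R 4) (h : RelDecomp R X Y Z) :
    ¬ Piece R (X ++ Y) := by
  intro hp
  have := h.2.1.2.2 _ ⟨Z, rfl⟩ hp
  have hY := List.length_pos_iff.2 (h.middle_ne_nil hC)
  simp only [List.length_append] at this
  omega

theorem not_piece_middle (hC : WeaklyC R 4) (h : RelDecomp R X Y Z) : ¬ Piece R Y := by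
  intro hp
  have := hC _ h.1 [X, Y, Z] (by simp [hp, h.2.1.2.1, h.2.2.2.1]) (by simp)
  simp at this

theorem not_piece_suffix {Y₀ s : List A} (h : RelDecomp R X (Y₀ ++ s) Z) (hs : s ≠ []) :
    ¬ Piece R (s ++ Z) := by
  intro hp
  have := h.2.2.2.2 _ ⟨X ++ Y₀, by simp⟩ hp
  have hs := List.length_pos_iff.2 hs
  simp only [List.length_append] at this
  omega

theorem eq_of_eq (h : RelDecomp R X Y Z) (h₁ : RelDecomp R X₁ Y₁ Z₁)
    (e : X ++ Y ++ Z = X₁ ++ Y₁ ++ Z₁) : X = X₁ ∧ Y = Y₁ ∧ Z = Z₁ := by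
  have hX : X = X₁ := by
    refine (List.prefix_of_prefix_length_le h.2.1.1 (e ▸ h₁.2.1.1) ?_).eq_of_length_le ?_
    · exact h₁.2.1.2.2 _ (e ▸ h.2.1.1) h.2.1.2.1
    · exact h.2.1.2.2 _ (e ▸ h₁.2.1.1) h₁.2.1.2.1
  have hZ : Z = Z₁ := by
    refine (List.suffix_of_suffix_length_le h.2.2.1 (e ▸ h₁.2.2.1) ?_).eq_of_length_le ?_
    · exact h₁.2.2.2.2 _ (e ▸ h.2.2.1) h.2.2.2.1
    · exact h.2.2.2.2 _ (e ▸ h₁.2.2.1) h₁.2.2.2.1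
  subst hX hZ
  simpa using e

theorem prefix_of_piece (hC : WeaklyC R 4) (h : RelDecomp R X Y Z) {p t : List A}
    (hp : Piece R p) (hpt : p <+: X ++ Y ++ t) : p <+: X := by
  rcases List.prefix_or_prefix_of_prefix hpt (List.prefix_append (X ++ Y) t) with h₁ | h₁
  · have hl := h.2.1.2.2 p (h₁.trans (List.prefix_append _ Z)) hp
    exact List.prefix_of_prefix_length_le h₁ (List.prefix_append X Y) hl
  · exact absurd (hp.of_isInfix h₁.isInfix) (h.not_piece_head hC)

theorem sync_aux (hC : WeaklyC R 4) {b c P P₁ : List A}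
    (h : RelDecomp R (b ++ P) Y Z) (h₁ : RelDecomp R (c ++ P₁) Y₁ Z₁)
    (hP : P ++ Y <+: P₁ ++ Y₁) :
    b = c ∧ b ++ P ++ Y ++ Z = c ++ P₁ ++ Y₁ ++ Z₁ := by
  by_contra hne
  obtain ⟨t, ht⟩ := hP
  have : Piece R (P ++ Y) := by
    refine Or.inr ⟨_, _, b, Z, c, t ++ Z₁, h.1, h₁.1, by simp, ?_, ?_⟩
    · calc c ++ P₁ ++ Y₁ ++ Z₁ = c ++ (P₁ ++ Y₁) ++ Z₁ := by simp
        _ = _ := by rw [← ht]; simp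
    · tauto
  exact h.not_piece_middle hC (this.of_isInfix ⟨P, [], by simp⟩)

theorem sync (hC : WeaklyC R 4) {b c P P₁ w : List A}
    (h : RelDecomp R (b ++ P) Y Z) (h₁ : RelDecomp R (c ++ P₁) Y₁ Z₁)
    (hw : P ++ Y <+: w) (hw₁ : P₁ ++ Y₁ <+: w) :
    b = c ∧ b ++ P ++ Y ++ Z = c ++ P₁ ++ Y₁ ++ Z₁ := by
  rcases List.prefix_or_prefix_of_prefix hw hw₁ with hP | hP
  · exact sync_aux hC h h₁ hP
  · exact (sync_aux hC h₁ h hP).imp Eq.symm Eq.symm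

theorem head_unique (hC : WeaklyC R 4) {v : List A} (h : RelDecomp R X Y Z)
    (h₁ : RelDecomp R X₁ Y₁ Z₁) (hv : X ++ Y <+: v) (hv₁ : X₁ ++ Y₁ <+: v) :
    X = X₁ ∧ Y = Y₁ ∧ Z = Z₁ :=
  h.eq_of_eq h₁ (sync hC (b := []) (c := []) h h₁ hv hv₁).2

theorem not_head_and_suffix (hC : WeaklyC R 4) {Y₀ s t : List A}
    (h : RelDecomp R X (Y₀ ++ s) Z) (hY₀ : Y₀ ≠ []) (hs : s ≠ [])
    (h₁ : RelDecomp R X₁ Y₁ Z₁) (ht₁ : X₁ ++ Y₁ <+: t) (ht : s ++ Z <+: t) : False := by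
  rcases List.prefix_or_prefix_of_prefix ht₁ ht with ⟨d, hd⟩ | ⟨d, hd⟩
  · refine h₁.not_piece_head hC (Or.inr ⟨_, _, [], Z₁, X ++ Y₀, d, h₁.1, h.1, by simp, ?_,
      Or.inr (by simp [hY₀])⟩)
    calc X ++ (Y₀ ++ s) ++ Z = X ++ Y₀ ++ (s ++ Z) := by simp
      _ = _ := by rw [← hd]; simp
  · refine h.not_piece_suffix hs (Or.inr ⟨_, _, X ++ Y₀, [], [], d ++ Z₁, h.1, h₁.1, by simp,
      ?_, Or.inr (by simp [hY₀])⟩)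
    rw [← hd]
    simp

end RelDecomp

/-- No maximal piece prefix with its middle word starts strictly inside `Y` in `Y ++ u`. -/
def CleanHead (R : Finset (List A × List A)) (Y u : List A) : Prop :=
  ∀ Y₀ s X₁ Y₁ Z₁, Y = Y₀ ++ s → Y₀ ≠ [] → s ≠ [] → RelDecomp R X₁ Y₁ Z₁ →
    ¬ X₁ ++ Y₁ <+: s ++ u

theorem RelDecomp.cleanHead (hC : WeaklyC R 4) {X Y Z : List A} (h : RelDecomp R X Y Z)
    (w : List A) : CleanHead R Y (Z ++ w) := by
  rintro Y₀ s X₁ Y₁ Z₁ rfl hY₀ hs h₁ hpre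
  exact h.not_head_and_suffix hC hY₀ hs h₁ hpre ⟨w, by simp⟩

theorem CleanOverlapPrefix.cleanHead {X Y Z u' : List A}
    (h : CleanOverlapPrefix R (X ++ Y ++ u') [] X Y Z) : CleanHead R Y u' := by
  rintro Y₀ s X₁ Y₁ Z₁ rfl hY₀ hs h₁ ⟨t, ht⟩
  refine h.2.2 ⟨Y₀, X₁, Y₁, Z₁, h₁, hY₀, ⟨s, rfl⟩, by simpa using hs, t, ?_⟩
  calc [] ++ X ++ Y₀ ++ X₁ ++ Y₁ ++ t = X ++ Y₀ ++ (X₁ ++ Y₁ ++ t) := by simp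
    _ = _ := by rw [ht]; simp

/-- A rewriting step from `X ++ Y ++ v` rewrites the relation word at the head, or acts in
the tail `v`, or rewrites a relation word starting strictly inside `Y`. -/
theorem OneStep.head_cases (hC : WeaklyC R 4) {X Y Z v v₁ : List A}
    (h : RelDecomp R X Y Z) (hs : OneStep R (X ++ Y ++ v) v₁) :
    (∃ y w, ((X ++ Y ++ Z, y) ∈ R ∨ (y, X ++ Y ++ Z) ∈ R) ∧ v = Z ++ w ∧ v₁ = y ++ w) ∨
    (∃ v', v₁ = X ++ Y ++ v' ∧ OneStep R v v') ∨
    (∃ Y₀ s X₁ Y₁ Z₁ w, Y = Y₀ ++ s ∧ Y₀ ≠ [] ∧ s ≠ [] ∧ RelDecomp R X₁ Y₁ Z₁ ∧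
      s ++ v = X₁ ++ Y₁ ++ (Z₁ ++ w)) := by
  obtain ⟨l, r, x, y, hxy, hu, rfl⟩ := hs
  obtain ⟨X₁, Y₁, Z₁, hx, h₁⟩ := hC.exists_relDecomp (relWord_left hxy)
  rw [List.append_assoc l] at hu
  rcases List.append_eq_append_iff.1 hu with ⟨l', rfl, hv⟩ | ⟨s, hXY, hxr⟩
  · exact Or.inr (Or.inl ⟨l' ++ y ++ r, by simp, l', r, x, y, hxy, by simp [hv], rfl⟩)
  by_cases hs : s = []
  · subst hs
    simp only [List.append_nil] at hXY
    subst hXY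
    exact Or.inr (Or.inl ⟨y ++ r, by simp, [], r, x, y, hxy, by simpa using hxr.symm, rfl⟩)
  by_cases hl : l = []
  · subst hl
    simp only [List.nil_append] at hXY
    subst hXY
    obtain ⟨rfl, rfl, rfl⟩ := h.head_unique hC h₁ ⟨v, rfl⟩
      (show X₁ ++ Y₁ <+: _ from ⟨Z₁ ++ r, by rw [← hxr, hx]; simp⟩)
    refine Or.inl ⟨y, r, hx ▸ hxy, ?_, by simp⟩
    rw [hx, List.append_assoc (X ++ Y)] at hxr
    exact (List.append_cancel_left hxr).symm
  rcases List.append_eq_append_iff.1 hXY with ⟨Y₀, rfl, hY⟩ | ⟨m, rfl, rfl⟩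
  · by_cases hY₀ : Y₀ = []
    · subst hY₀
      exfalso
      simp only [List.append_nil, List.nil_append] at hl hY hxr
      subst hY
      rcases List.prefix_or_prefix_of_prefix (⟨r, hxr⟩ : x <+: Y ++ v)
        (List.prefix_append Y v) with ⟨d, rfl⟩ | ⟨d, rfl⟩
      · exact hC.not_piece (relWord_left hxy) (Or.inr ⟨_, _, [], [], X, d ++ Z,
          relWord_left hxy, h.1, by simp, by simp, Or.inr (Ne.symm hl)⟩)
      · exact h.not_piece_middle hC (Or.inr ⟨_, _, [], d, X, Z,
          relWord_left hxy, h.1, by simp, by simp, Or.inr (Ne.symm hl)⟩)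
    · exact Or.inr (Or.inr ⟨Y₀, s, X₁, Y₁, Z₁, r, hY, hY₀, hs, h₁, by
        rw [← hxr, hx]; simp⟩)
  · exfalso
    rcases List.prefix_or_prefix_of_prefix (⟨r, hxr⟩ : x <+: m ++ Y ++ v)
      (List.prefix_append (m ++ Y) v) with ⟨d, hd⟩ | ⟨d, rfl⟩
    · refine hC.not_piece (relWord_left hxy) (Or.inr ⟨_, _, [], [], l, d ++ Z,
        relWord_left hxy, h.1, by simp, ?_, Or.inr (Ne.symm hl)⟩)
      calc l ++ m ++ Y ++ Z = l ++ (m ++ Y) ++ Z := by simp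
        _ = _ := by rw [← hd]; simp
    · exact h.not_piece_middle hC (Or.inr ⟨_, _, m, d, l ++ m, Z,
        relWord_left hxy, h.1, by simp, by simp, Or.inr (by simpa using Ne.symm hl)⟩)

namespace RelComplement

theorem mequiv {r s : List A} (h : RelComplement R r s) : MEquiv R r s := by
  refine Relation.ReflTransGen.mono (fun x y hxy => ?_) _ _ h.2
  exact ⟨[], [], x, y, hxy, by simp, by simp⟩

theorem symm {r s : List A} (h : RelComplement R r s) : RelComplement R s r := by
  have : Std.Symm (fun s t : List A => (s, t) ∈ R ∨ (t, s) ∈ R) := ⟨fun _ _ => Or.symm⟩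
  refine ⟨?_, Relation.ReflTransGen.stdSymm.symm _ _ h.2⟩
  obtain ⟨hr, h⟩ := h
  cases h with
  | refl => exact hr
  | tail _ h => exact relWord_right h

theorem tail {r s t : List A} (h : RelComplement R r s) (hst : (s, t) ∈ R ∨ (t, s) ∈ R) :
    RelComplement R r t :=
  ⟨h.1, h.2.tail hst⟩

end RelComplement

theorem RelDecomp.relComplement_self {X Y Z : List A} (h : RelDecomp R X Y Z) :
    RelComplement R (X ++ Y ++ Z) (X ++ Y ++ Z) :=
  ⟨h.1, Relation.ReflTransGen.refl⟩

/-- Every derivation from `X ++ Y ++ u` with clean head keeps a complement of the head. -/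
theorem StepsN.head_form (hC : WeaklyC R 4) (n : ℕ) :
    ∀ {X Y Z u v : List A}, RelDecomp R X Y Z → CleanHead R Y u →
      StepsN R n (X ++ Y ++ u) v →
      (∃ v', v = X ++ Y ++ v' ∧ ∃ m ≤ n, StepsN R m u v') ∨
      (∃ X' Y' Z' v' w, RelComplement R (X ++ Y ++ Z) (X' ++ Y' ++ Z') ∧
        RelDecomp R X' Y' Z' ∧ v = X' ++ Y' ++ v' ∧
        ∃ m < n, StepsN R m (Z' ++ w) v') := by
  induction n using Nat.strong_induction_on with
  | _ n ih =>
  intro X Y Z u v hD hc hst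
  cases n with
  | zero => exact Or.inl ⟨u, hst.symm, 0, le_rfl, rfl⟩
  | succ n =>
  have inner : ∀ {m X₁ Y₁ Z₁ w t}, m ≤ n → RelDecomp R X₁ Y₁ Z₁ →
      StepsN R m (X₁ ++ Y₁ ++ (Z₁ ++ w)) t →
      ∃ X₂ Y₂ Z₂, RelDecomp R X₂ Y₂ Z₂ ∧ X₂ ++ Y₂ <+: t := by
    intro m X₁ Y₁ Z₁ w t hm h₁ ht
    rcases ih m (by omega) h₁ (h₁.cleanHead hC w) ht with
      ⟨v', rfl, -⟩ | ⟨X₂, Y₂, Z₂, v', -, -, h₂, rfl, -⟩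
    · exact ⟨_, _, _, h₁, v', rfl⟩
    · exact ⟨_, _, _, h₂, v', rfl⟩
  have rewrite_head : ∀ {r y w}, RelComplement R (X ++ Y ++ Z) r →
      ((r, y) ∈ R ∨ (y, r) ∈ R) →
      ∃ X' Y' Z' v' w', RelComplement R (X ++ Y ++ Z) (X' ++ Y' ++ Z') ∧
        RelDecomp R X' Y' Z' ∧ y ++ w = X' ++ Y' ++ v' ∧
        ∃ m < n + 1, StepsN R m (Z' ++ w') v' := by
    intro r y w hr hry
    obtain ⟨X', Y', Z', rfl, h'⟩ := hC.exists_relDecomp (relWord_right hry)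
    exact ⟨X', Y', Z', Z' ++ w, w, hr.tail hry, h', by simp, 0, by omega, rfl⟩
  obtain ⟨t, ht, hs⟩ := hst
  rcases ih n (by omega) hD hc ht with
    ⟨v', rfl, m, hm, hv'⟩ | ⟨X', Y', Z', v', w, hcomp, hD', rfl, m, hm, hv'⟩
  · rcases hs.head_cases hC hD with ⟨y, w, hy, rfl, rfl⟩ | ⟨v₂, rfl, hv₂⟩ |
      ⟨Y₀, s, X₁, Y₁, Z₁, w, rfl, hY₀, hs', h₁, e⟩
    · exact Or.inr (rewrite_head hD.relComplement_self hy)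
    · exact Or.inl ⟨v₂, rfl, m + 1, by omega, v', hv', hv₂⟩
    · obtain ⟨X₂, Y₂, Z₂, h₂, hpre⟩ := inner hm h₁ (e ▸ (hv'.append_left s).symm)
      exact absurd hpre (hc _ _ _ _ _ rfl hY₀ hs' h₂)
  · rcases hs.head_cases hC hD' with ⟨y, w, hy, rfl, rfl⟩ | ⟨v₂, rfl, hv₂⟩ |
      ⟨Y₀, s, X₁, Y₁, Z₁, w', rfl, hY₀, hs', h₁, e⟩
    · exact Or.inr (rewrite_head hcomp hy)
    · exact Or.inr ⟨X', Y', Z', v₂, w, hcomp, hD', rfl, m + 1, by omega, v', hv', hv₂⟩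
    · obtain ⟨X₂, Y₂, Z₂, h₂, hpre⟩ := inner hm.le h₁ (e ▸ (hv'.append_left s).symm)
      exact (hD'.not_head_and_suffix hC hY₀ hs' h₂ hpre ⟨w, by simp⟩).elim

/-- A word equivalent to one with a clean head has a complement head. -/
theorem MEquiv.exists_head (hC : WeaklyC R 4) {X Y Z u v : List A}
    (hD : RelDecomp R X Y Z) (hc : CleanHead R Y u) (h : MEquiv R (X ++ Y ++ u) v) :
    ∃ X' Y' Z', RelDecomp R X' Y' Z' ∧ X' ++ Y' <+: v := by
  obtain ⟨n, hn⟩ := StepsN.exists_of_mequiv h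
  rcases StepsN.head_form hC n hD hc hn with
    ⟨v', rfl, -⟩ | ⟨X', Y', Z', v', -, -, h', rfl, -⟩
  · exact ⟨X, Y, Z, hD, v', rfl⟩
  · exact ⟨X', Y', Z', h', v', rfl⟩

/-- A word equivalent to one starting with a relation word starts with a maximal piece
prefix followed by its middle word. -/
theorem MEquiv.prefix_of_relWord (hC : WeaklyC R 4) {r c v : List A} (hr : RelWord R r)
    (h : MEquiv R (r ++ c) v) : ∃ X Y Z, RelDecomp R X Y Z ∧ X ++ Y <+: v := by
  obtain ⟨X, Y, Z, rfl, hD⟩ := hC.exists_relDecomp hr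
  exact MEquiv.exists_head hC hD (hD.cleanHead hC c) (by simpa using h)

/-- `b ++ w` is equivalent to a word starting with a relation word. -/
def Activates (R : Finset (List A × List A)) (b w : List A) : Prop :=
  ∃ r c, RelWord R r ∧ MEquiv R (r ++ c) (b ++ w)

theorem Activates.congr {b w w' : List A} (h : Activates R b w)
    (hw : MEquiv R (b ++ w) (b ++ w')) : Activates R b w' := by
  obtain ⟨r, c, hr, h⟩ := h
  exact ⟨r, c, hr, h.trans hw⟩

theorem Activates.eq (hC : WeaklyC R 4) {b c w : List A} (hb : Piece R b)
    (hc : Piece R c) (h : Activates R b w) (h' : Activates R c w) : b = c := by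
  obtain ⟨r, d, hr, h⟩ := h
  obtain ⟨r', d', hr', h'⟩ := h'
  obtain ⟨X, Y, Z, hD, hpre⟩ := h.prefix_of_relWord hC hr
  obtain ⟨X', Y', Z', hD', hpre'⟩ := h'.prefix_of_relWord hC hr'
  have split : ∀ {b X Y Z : List A}, Piece R b → RelDecomp R X Y Z → X ++ Y <+: b ++ w →
      ∃ P, X = b ++ P ∧ P ++ Y <+: w := by
    rintro b X Y Z hb hD ⟨t, ht⟩
    obtain ⟨P, rfl⟩ := hD.prefix_of_piece hC hb (t := t) (ht ▸ List.prefix_append b w)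
    exact ⟨P, rfl, t, by simpa using ht⟩
  obtain ⟨P, rfl, hP⟩ := split hb hD hpre
  obtain ⟨P', rfl, hP'⟩ := split hc hD' hpre'
  exact (hD.sync hC hD' hP hP').1

/-- Words equivalent to `p ++ w` with `p` a piece: either `p` is kept as a prefix, or some
nonempty suffix `b` of `p` is activated by `w` and the rest of `p` is kept. -/
theorem Piece.mequiv_append_cases (hC : WeaklyC R 4) {p w u : List A} (hp : Piece R p)
    (h : MEquiv R (p ++ w) u) :
    (∃ u', u = p ++ u' ∧ MEquiv R w u') ∨
    (∃ a b t, p = a ++ b ∧ b ≠ [] ∧ Activates R b w ∧ u = a ++ t ∧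
      MEquiv R (b ++ w) t) := by
  by_cases hact : ∃ a b w' r c, p = a ++ b ∧ b ≠ [] ∧ MEquiv R w w' ∧ RelWord R r ∧
      b ++ w' = r ++ c
  · obtain ⟨a, b, w', r, c, rfl, hb, hw, hr, e⟩ := hact
    right
    have hact : ∀ {t}, MEquiv R (b ++ w) t → MEquiv R (r ++ c) t := fun h =>
      e ▸ (hw.append_left b).symm.trans h
    suffices ∃ t, u = a ++ t ∧ MEquiv R (b ++ w) t by
      obtain ⟨t, hu, ht⟩ := this
      exact ⟨a, b, t, rfl, hb, ⟨r, c, hr, hact (MEquiv.refl _)⟩, hu, ht⟩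
    induction h with
    | refl => exact ⟨b ++ w, by simp, MEquiv.refl _⟩
    | tail _ hs ih =>
      obtain ⟨t, rfl, ht⟩ := ih
      obtain ⟨l, r', x, y, hxy, hu, rfl⟩ := hs
      have tail_step : ∀ {l' : List A}, t = l' ++ x ++ r' →
          MEquiv R (b ++ w) (l' ++ y ++ r') := fun h =>
        ht.trans (Relation.ReflTransGen.single ⟨_, r', x, y, hxy, h, rfl⟩)
      rw [List.append_assoc l] at hu
      rcases List.append_eq_append_iff.1 hu with ⟨l', rfl, rfl⟩ | ⟨m, rfl, hm⟩
      · exact ⟨l' ++ y ++ r', by simp, tail_step (by simp)⟩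
      by_cases hm0 : m = []
      · subst hm0
        exact ⟨y ++ r', by simp, tail_step (l' := []) (by simpa using hm.symm)⟩
      exfalso
      obtain ⟨X, Y, Z, hD, s, rfl⟩ := (hact ht).prefix_of_relWord hC hr
      have hmp : Piece R m := hp.of_isInfix ⟨l, b, by simp⟩
      have hx := relWord_left hxy
      rcases List.append_eq_append_iff.1 hm with ⟨d, rfl, -⟩ | ⟨d, rfl, hd⟩
      · exact hC.not_piece hx (hmp.of_isInfix ⟨[], d, by simp⟩)
      · rcases List.prefix_or_prefix_of_prefix (⟨r', hd.symm⟩ : d <+: _)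
          (List.prefix_append (X ++ Y) s) with ⟨e', he'⟩ | ⟨e', rfl⟩
        · refine hC.ne_append hmp (Or.inr ⟨_, _, m, [], [], e' ++ Z, hx, hD.1, by simp, ?_,
            Or.inr hm0⟩) hx
          rw [← he']
          simp
        · exact hD.not_piece_head hC (Or.inr ⟨_, _, m, e', [], Z, hx, hD.1, by simp,
            by simp, Or.inr hm0⟩)
  · left
    induction h with
    | refl => exact ⟨w, rfl, MEquiv.refl _⟩
    | tail _ hs ih =>
      obtain ⟨t, rfl, ht⟩ := ih
      obtain ⟨l, r', x, y, hxy, hu, rfl⟩ := hs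
      have tail_step : ∀ {l' : List A}, t = l' ++ x ++ r' →
          MEquiv R w (l' ++ y ++ r') := fun h =>
        ht.trans (Relation.ReflTransGen.single ⟨_, r', x, y, hxy, h, rfl⟩)
      rw [List.append_assoc l] at hu
      rcases List.append_eq_append_iff.1 hu with ⟨l', rfl, rfl⟩ | ⟨m, rfl, hm⟩
      · exact ⟨l' ++ y ++ r', by simp, tail_step (by simp)⟩
      by_cases hm0 : m = []
      · subst hm0
        exact ⟨y ++ r', by simp, tail_step (l' := []) (by simpa using hm.symm)⟩
      exact absurd ⟨l, m, t, x, r', rfl, hm0, ht, relWord_left hxy, hm.symm⟩ hact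

/-- `w` and `w'` are equivalent, or become so after prefixing a suffix of some maximal piece
suffix of a complement of `X ++ Y ++ Z` which they activate. -/
def TailRel (R : Finset (List A × List A)) (X Y Z w w' : List A) : Prop :=
  MEquiv R w w' ∨ ∃ a b, ZComp R X Y Z (a ++ b) ∧ Activates R b w ∧
    MEquiv R (b ++ w) (b ++ w')

theorem ZComp.piece {X Y Z Z' : List A} (h : ZComp R X Y Z Z') : Piece R Z' := by
  obtain ⟨_, _, _, h⟩ := h
  exact h.2.2.2.1

theorem TailRel.trans (hC : WeaklyC R 4) {X Y Z w₁ w₂ w₃ : List A}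
    (h : TailRel R X Y Z w₁ w₂) (h' : TailRel R X Y Z w₂ w₃) : TailRel R X Y Z w₁ w₃ := by
  rcases h with h | ⟨a, b, hab, hact, h⟩
  · rcases h' with h' | ⟨a', b', hab', hact', h'⟩
    · exact Or.inl (h.trans h')
    · exact Or.inr ⟨a', b', hab', hact'.congr (h.symm.append_left b'),
        (h.append_left b').trans h'⟩
  · rcases h' with h' | ⟨a', b', hab', hact', h'⟩
    · exact Or.inr ⟨a, b, hab, hact, h.trans (h'.append_left b)⟩
    · obtain rfl : b = b' := (hact.congr h).eq hC (hab.piece.of_isInfix ⟨a, [], by simp⟩)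
        (hab'.piece.of_isInfix ⟨a', [], by simp⟩) hact'
      exact Or.inr ⟨a, b, hab, hact, h.trans h'⟩

theorem ZComp.tailRel_of_mequiv (hC : WeaklyC R 4) {X Y Z Z' w w' : List A}
    (hZ : ZComp R X Y Z Z') (h : MEquiv R (Z' ++ w) (Z' ++ w')) :
    TailRel R X Y Z w w' := by
  rcases hZ.piece.mequiv_append_cases hC h with ⟨u, hu, hw⟩ | ⟨a, b, t, rfl, -, hact, hu, ht⟩
  · rw [List.append_cancel_left hu]
    exact Or.inl hw
  · rw [List.append_assoc] at hu
    exact Or.inr ⟨a, b, hZ, hact, List.append_cancel_left hu ▸ ht⟩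

theorem TailRel.exists_zComp {X Y Z w w' : List A} (hD : RelDecomp R X Y Z)
    (h : TailRel R X Y Z w w') : ∃ Z', ZComp R X Y Z Z' ∧ MEquiv R (Z' ++ w) (Z' ++ w') := by
  rcases h with h | ⟨a, b, hab, -, h⟩
  · exact ⟨Z, ⟨X, Y, hD.relComplement_self, hD⟩, h.append_left Z⟩
  · exact ⟨a ++ b, hab, by simpa using h.append_left a⟩

/-- The words equivalent to `X ++ Y ++ u` with clean head: either the head was never
rewritten, or `u` is equivalent to a word starting with `Z`. -/
theorem MEquiv.head_tail_form (hC : WeaklyC R 4) {X Y Z u v : List A}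
    (hD : RelDecomp R X Y Z) (hc : CleanHead R Y u) (h : MEquiv R (X ++ Y ++ u) v) :
    (∃ v', v = X ++ Y ++ v' ∧ MEquiv R u v') ∨
    (∃ X' Y' Z' v' w w', RelComplement R (X ++ Y ++ Z) (X' ++ Y' ++ Z') ∧
      RelDecomp R X' Y' Z' ∧ v = X' ++ Y' ++ v' ∧ MEquiv R u (Z ++ w) ∧
      MEquiv R v' (Z' ++ w') ∧ TailRel R X Y Z w w') := by
  induction h with
  | refl => exact Or.inl ⟨u, rfl, MEquiv.refl _⟩
  | @tail v v₁ hv hs ih =>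
    rcases ih with ⟨v', rfl, hv'⟩ | ⟨X', Y', Z', v', w, w', hcomp, hD', rfl, hu, hv', hw⟩
    · rcases hs.head_cases hC hD with ⟨y, w, hy, rfl, rfl⟩ | ⟨v₂, rfl, hv₂⟩ |
        ⟨Y₀, s, X₁, Y₁, Z₁, w, rfl, hY₀, hs', h₁, e⟩
      · obtain ⟨X', Y', Z', rfl, h'⟩ := hC.exists_relDecomp (relWord_right hy)
        exact Or.inr ⟨X', Y', Z', Z' ++ w, w, w, hD.relComplement_self.tail hy, h', by simp,
          hv', MEquiv.refl _, Or.inl (MEquiv.refl _)⟩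
      · exact Or.inl ⟨v₂, rfl, Relation.ReflTransGen.tail hv' hv₂⟩
      · have hsu : MEquiv R (X₁ ++ Y₁ ++ Z₁ ++ w) (s ++ u) := by
          rw [List.append_assoc (X₁ ++ Y₁), ← e]
          exact (hv'.append_left s).symm
        obtain ⟨X₂, Y₂, Z₂, h₂, hpre⟩ := hsu.prefix_of_relWord hC h₁.1
        exact absurd hpre (hc _ _ _ _ _ rfl hY₀ hs' h₂)
    · rcases hs.head_cases hC hD' with ⟨y, w₂, hy, rfl, rfl⟩ | ⟨v₂, rfl, hv₂⟩ |
        ⟨Y₀, s, X₁, Y₁, Z₁, w₂, rfl, hY₀, hs', h₁, e⟩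
      · obtain ⟨X₂, Y₂, Z₂, rfl, h₂⟩ := hC.exists_relDecomp (relWord_right hy)
        have hZ' : ZComp R X Y Z Z' := ⟨X', Y', hcomp, hD'⟩
        exact Or.inr ⟨X₂, Y₂, Z₂, Z₂ ++ w₂, w, w₂, hcomp.tail hy, h₂, by simp, hu,
          MEquiv.refl _, hw.trans hC (hZ'.tailRel_of_mequiv hC hv'.symm)⟩
      · exact Or.inr ⟨X', Y', Z', v₂, w, w', hcomp, hD', rfl, hu,
          (Relation.ReflTransGen.single hv₂.symm : MEquiv R v₂ v').trans hv', hw⟩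
      · have hsv : MEquiv R (X₁ ++ Y₁ ++ Z₁ ++ w₂) (s ++ (Z' ++ w')) := by
          rw [List.append_assoc (X₁ ++ Y₁), ← e]
          exact hv'.append_left s
        obtain ⟨X₂, Y₂, Z₂, h₂, hpre⟩ := hsv.prefix_of_relWord hC h₁.1
        exact (hD'.not_head_and_suffix hC hY₀ hs' h₂ hpre ⟨w', by simp⟩).elim

/-- The possible shapes of `u` and `v` when `u ≡ Z ++ w` and `v ≡ Z' ++ w'` with `w` and `w'`
related as tails. -/
inductive TailShape (R : Finset (List A × List A)) (X Y Z Z' u v : List A) : Prop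
  | both (u' v' Zh : List A) (hu : u = Z ++ u') (hv : v = Z' ++ v')
      (hZh : ZComp R X Y Z Zh) (h : MEquiv R (Zh ++ u') (Zh ++ v'))
  | right (v' : List A) (hv : v = Z' ++ v') (hn : ¬ Z <+: u) (h : MEquiv R u (Z ++ v'))
  | left (u' : List A) (hu : u = Z ++ u') (hn : ¬ Z' <+: v) (h : MEquiv R (Z' ++ u') v)
  | neither (hn : ¬ Z <+: u) (hn' : ¬ Z' <+: v) (y a a' b t t' : List A)
      (huy : MEquiv R u (Z ++ y)) (hvy : MEquiv R v (Z' ++ y)) (hZ : Z = a ++ b)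
      (hZ' : Z' = a' ++ b) (hb : b ≠ []) (hu : u = a ++ t) (hv : v = a' ++ t')
      (ht : MEquiv R t (b ++ y)) (ht' : MEquiv R t' (b ++ y))

namespace TailShape

variable {X Y Z Z' u v : List A}

theorem of_prefix_left (hZ' : ZComp R X Y Z Z') {y u' : List A} (hu' : u = Z ++ u')
    (hvy : MEquiv R v (Z' ++ y)) (huy : MEquiv R (Z' ++ u') (Z' ++ y)) :
    TailShape R X Y Z Z' u v := by
  by_cases hpre : Z' <+: v
  · obtain ⟨v', rfl⟩ := hpre
    exact both u' v' Z' hu' rfl hZ' (huy.trans hvy.symm)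
  · exact left u' hu' hpre (huy.trans hvy.symm)

theorem of_prefix_right (hZ : ZComp R X Y Z Z) {y v' : List A} (hv' : v = Z' ++ v')
    (huy : MEquiv R u (Z ++ y)) (hyv : MEquiv R (Z ++ y) (Z ++ v')) :
    TailShape R X Y Z Z' u v := by
  by_cases hpre : Z <+: u
  · obtain ⟨u', rfl⟩ := hpre
    exact both u' v' Z rfl hv' hZ (huy.trans hyv)
  · exact right v' hv' hpre (huy.trans hyv)

theorem of_common (hC : WeaklyC R 4) (hZ : ZComp R X Y Z Z) (hZ' : ZComp R X Y Z Z')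
    {y : List A} (huy : MEquiv R u (Z ++ y)) (hvy : MEquiv R v (Z' ++ y)) :
    TailShape R X Y Z Z' u v := by
  rcases hZ.piece.mequiv_append_cases hC huy.symm with
    ⟨u', hu', hy⟩ | ⟨a, b, t, hab, hb, hact, hu', ht⟩
  · exact of_prefix_left hZ' hu' hvy (hy.symm.append_left Z')
  rcases hZ'.piece.mequiv_append_cases hC hvy.symm with
    ⟨v', hv', hy⟩ | ⟨a', b', t', hab', hb', hact', hv', ht'⟩
  · exact of_prefix_right hZ hv' huy (hy.append_left Z)
  obtain rfl : b = b' := hact.eq hC (hZ.piece.of_isInfix ⟨a, [], by simp [hab]⟩)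
    (hZ'.piece.of_isInfix ⟨a', [], by simp [hab']⟩) hact'
  by_cases hpre : Z <+: u
  · obtain ⟨u', hu''⟩ := hpre
    have e : t = b ++ u' := by
      rw [← hu'', hab, List.append_assoc] at hu'
      exact (List.append_cancel_left hu').symm
    refine of_prefix_left hZ' hu''.symm hvy ?_
    rw [hab', List.append_assoc, List.append_assoc, ← e]
    exact ht.symm.append_left a'
  by_cases hpre' : Z' <+: v
  · obtain ⟨v', hv''⟩ := hpre'
    have e : t' = b ++ v' := by
      rw [← hv'', hab', List.append_assoc] at hv'
      exact (List.append_cancel_left hv').symm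
    refine of_prefix_right hZ hv''.symm huy ?_
    rw [hab, List.append_assoc, List.append_assoc, ← e]
    exact ht'.append_left a
  exact neither hpre hpre' y a a' b t t' huy hvy hab hab' hb hu' hv' ht.symm ht'.symm

end TailShape

theorem TailRel.tailShape (hC : WeaklyC R 4) {X Y Z Z' u v w w' : List A}
    (hD : RelDecomp R X Y Z) (hZ' : ZComp R X Y Z Z') (hu : MEquiv R u (Z ++ w))
    (hv : MEquiv R v (Z' ++ w')) (h : TailRel R X Y Z w w') :
    TailShape R X Y Z Z' u v := by
  have hZ : ZComp R X Y Z Z := ⟨X, Y, hD.relComplement_self, hD⟩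
  obtain ⟨Zh, hZh, hZhw⟩ := h.exists_zComp hD
  rcases h with h | ⟨a₀, b₀, hab₀, hact₀, hw⟩
  · exact .of_common hC hZ hZ' (hu.trans (h.append_left Z)) hv
  rcases hZ.piece.mequiv_append_cases hC hu.symm with
    ⟨u', hu', hy⟩ | ⟨a, b, t, hab, hb, hact, hu', ht⟩
  · rcases hZ'.piece.mequiv_append_cases hC hv.symm with
      ⟨v', hv', hy'⟩ | ⟨a', b', t', hab', hb', hact', hv', ht'⟩
    · exact .both u' v' Zh hu' hv' hZh
        (((hy.symm.append_left Zh).trans hZhw).trans (hy'.append_left Zh))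
    · obtain rfl : b₀ = b' := (hact₀.congr hw).eq hC
        (hab₀.piece.of_isInfix ⟨a₀, [], by simp⟩) (hZ'.piece.of_isInfix ⟨a', [], by simp [hab']⟩) hact'
      exact .of_common hC hZ hZ' hu (hv.trans (by simpa [hab'] using hw.symm.append_left a'))
  · obtain rfl : b₀ = b := hact₀.eq hC (hab₀.piece.of_isInfix ⟨a₀, [], by simp⟩)
      (hZ.piece.of_isInfix ⟨a, [], by simp [hab]⟩) hact
    exact .of_common hC hZ hZ' (hu.trans (by simpa [hab] using hw.append_left a)) hv

theorem exists_max_common_suffix {Z Z' b : List A} (h : b <:+ Z) (h' : b <:+ Z') :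
    ∃ z, z <:+ Z ∧ z <:+ Z' ∧ b <:+ z ∧
      ∀ w, w <:+ Z → w <:+ Z' → w.length ≤ z.length := by
  classical
  let P : ℕ → Prop := fun n => ∃ z, z <:+ Z ∧ z <:+ Z' ∧ z.length = n
  obtain ⟨z, hz, hz', hl⟩ := Nat.findGreatest_spec (P := P) h.length_le ⟨b, h, h', rfl⟩
  have hmax : ∀ w, w <:+ Z → w <:+ Z' → w.length ≤ z.length := fun w hw hw' =>
    hl ▸ Nat.le_findGreatest hw.length_le ⟨w, hw, hw', rfl⟩
  exact ⟨z, hz, hz', List.suffix_of_suffix_length_le h hz (hmax b h h'), hmax⟩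

theorem RelDecomp.uniqueComp (hC : WeaklyC R 4) {X Y Z r v : List A}
    (hD : RelDecomp R X Y Z) (hv : X ++ Y <+: v) : UniqueComp R r v X Y Z :=
  fun _ _ _ h hpre => h.2.1.head_unique hC hD hpre hv

/-- One of the six conditions holds for `v ≡ X ++ Y ++ u'`, given its prefix part for `p`. -/
theorem MEquiv.conditions (hC : WeaklyC R 4) {X Y Z u' v p : List A}
    (hD : RelDecomp R X Y Z) (hc : CleanHead R Y u') (hp : PrefXComp R X Y Z p)
    (hp' : p <+: X ∨ PossPrefix R Z u') (h : MEquiv R (X ++ Y ++ u') v) :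
    Cond1' R X Y Z u' v p ∨ Cond2' R X Y Z u' v p ∨ Cond3' R X Y Z u' v p ∨
      Cond4' R X Y Z u' v p ∨ Cond5' R X Y Z u' v p ∨ Cond6' R X Y Z u' v p := by
  have hp₂ : p <+: X ∨ (PrefXComp R X Y Z p ∧ PossPrefix R Z u') := hp'.imp_right (⟨hp, ·⟩)
  have hZ : ZComp R X Y Z Z := ⟨X, Y, hD.relComplement_self, hD⟩
  have same : ∀ {v'}, v = X ++ Y ++ v' → MEquiv R u' v' →
      Cond1' R X Y Z u' v p ∨ Cond2' R X Y Z u' v p := by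
    intro v' hv huv
    by_cases hpre : Z <+: u' ∧ Z <+: v'
    · obtain ⟨⟨u'', rfl⟩, v'', rfl⟩ := hpre
      exact Or.inl ⟨⟨u'', v'', rfl, by simp [hv], Z, hZ, huv⟩, hp⟩
    · exact Or.inr ⟨⟨v', hv, by tauto, huv⟩, hp₂⟩
  rcases h.head_tail_form hC hD hc with ⟨v', hv, huv⟩ |
    ⟨X', Y', Z', v', w, w', hcomp, hD', hv, hu, hv', hw⟩
  · have := same hv huv
    tauto
  have hZ' : ZComp R X Y Z Z' := ⟨X', Y', hcomp, hD'⟩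
  by_cases heq : X' ++ Y' ++ Z' = X ++ Y ++ Z
  · obtain ⟨rfl, rfl, rfl⟩ := hD'.eq_of_eq hD heq
    rcases hw.tailShape hC hD hZ' hu hv' with ⟨u'', v'', Zh, rfl, rfl, hZh, he⟩ |
      ⟨v'', rfl, -, he⟩ | ⟨u'', rfl, -, he⟩ | ⟨-, -, y, _, _, _, _, _, hy, hy'⟩
    · exact Or.inl ⟨⟨u'', v'', rfl, by simp [hv], Zh, hZh, he⟩, hp⟩
    · have := same hv he
      tauto
    · have := same hv he
      tauto
    · have := same hv (hy.trans hy'.symm)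
      tauto
  have hproper : ProperComp R (X ++ Y ++ Z) X' Y' Z' := ⟨hcomp, hD', heq⟩
  have huniq : UniqueComp R (X ++ Y ++ Z) v X' Y' Z' := hD'.uniqueComp hC ⟨v', hv.symm⟩
  right; right
  rcases hw.tailShape hC hD hZ' hu hv' with ⟨u'', v'', Zh, hu'', rfl, hZh, he⟩ |
    ⟨v'', rfl, hn, he⟩ | ⟨u'', hu'', hn, he⟩ |
    ⟨hn, hn', y, a, a', b, t, t', hy, hy', rfl, rfl, hb, rfl, rfl, ht, ht'⟩
  · exact Or.inl ⟨⟨X', Y', Z', u'', v'', hu'', hproper, by simp [hv], huniq, Zh, hZh, he⟩, hp⟩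
  · exact Or.inr (Or.inl ⟨⟨X', Y', Z', v'', hproper, by simp [hv], huniq, hn, he⟩, hp⟩)
  · exact Or.inr (Or.inr (Or.inl ⟨⟨X', Y', Z', u'', v', hu'', hproper, hv, huniq, hn, he⟩,
      hp⟩))
  · obtain ⟨z, ⟨z₁, hz₁⟩, ⟨z₂, hz₂⟩, ⟨c, rfl⟩, hmax⟩ :=
      exists_max_common_suffix (List.suffix_append a b) (List.suffix_append a' b)
    rw [← List.append_assoc] at hz₁ hz₂
    obtain rfl := List.append_cancel_right hz₁
    obtain rfl := List.append_cancel_right hz₂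
    refine Or.inr (Or.inr (Or.inr ⟨⟨X', Y', _, _, hproper, hv, huniq, hn, hn', c ++ b, z₁, z₂,
      c ++ t, c ++ t', by simp, by simp, hmax, by simp, by simp,
      (ht.trans ht'.symm).append_left c, by simp [hb], y, ?_⟩, hp⟩))
    simpa using (ht.append_left c).symm

/-- A piece which is a possible prefix of `X ++ Y ++ u'` is a prefix of a complement of `X`. -/
theorem PossPrefix.prefXComp (hC : WeaklyC R 4) {X Y Z u' p : List A}
    (hD : RelDecomp R X Y Z) (hc : CleanHead R Y u') (hp : Piece R p)
    (h : PossPrefix R p (X ++ Y ++ u')) :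
    PrefXComp R X Y Z p ∧ (p <+: X ∨ PossPrefix R Z u') := by
  obtain ⟨w, hw⟩ := h
  rcases hw.symm.head_tail_form hC hD hc with ⟨v', hv, -⟩ |
    ⟨X', Y', Z', v', w₁, -, hcomp, hD', hv, hu, -⟩
  · have := hD.prefix_of_piece hC hp (hv ▸ List.prefix_append p w)
    exact ⟨⟨X, ⟨Y, Z, hD.relComplement_self, hD⟩, this⟩, Or.inl this⟩
  · exact ⟨⟨X', ⟨Y', Z', hcomp, hD'⟩,
      hD'.prefix_of_piece hC hp (hv ▸ List.prefix_append p w)⟩, Or.inr ⟨w₁, hu.symm⟩⟩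

theorem RelComplement.mequiv_append {X Y Z X' Y' Z' : List A}
    (h : RelComplement R (X ++ Y ++ Z) (X' ++ Y' ++ Z')) (w : List A) :
    MEquiv R (X ++ Y ++ (Z ++ w)) (X' ++ Y' ++ (Z' ++ w)) := by
  simpa using h.mequiv.append_right w

theorem PrefXComp.possPrefix {X Y Z p u' : List A} (hp : PrefXComp R X Y Z p)
    (h : PossPrefix R Z u') : PossPrefix R p (X ++ Y ++ u') := by
  obtain ⟨X', ⟨Y', Z', hcomp, -⟩, t, rfl⟩ := hp
  obtain ⟨w, hw⟩ := h
  refine ⟨t ++ Y' ++ Z' ++ w, ?_⟩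
  simpa using (hcomp.mequiv_append w).symm.trans (hw.append_left (X ++ Y))

theorem possPrefix_append (p w : List A) : PossPrefix R p (p ++ w) :=
  ⟨w, MEquiv.refl _⟩

theorem ZComp.mequiv_append {X Y Z Z' u v : List A} (h : ZComp R X Y Z Z')
    (huv : MEquiv R (Z' ++ u) (Z' ++ v)) :
    MEquiv R (X ++ Y ++ (Z ++ u)) (X ++ Y ++ (Z ++ v)) := by
  obtain ⟨X', Y', hcomp, -⟩ := h
  exact ((hcomp.mequiv_append u).trans (huv.append_left (X' ++ Y'))).trans
    (hcomp.mequiv_append v).symm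

section Conditions

variable {X Y Z u' v p : List A}

theorem Cond1'.mequiv_and_possPrefix (h : Cond1' R X Y Z u' v p) :
    MEquiv R (X ++ Y ++ u') v ∧ PossPrefix R p (X ++ Y ++ u') := by
  obtain ⟨⟨u'', v'', rfl, rfl, Z', hZ', he⟩, hp⟩ := h
  exact ⟨by simpa using hZ'.mequiv_append he, hp.possPrefix (possPrefix_append _ _)⟩

theorem Cond2'.mequiv_and_possPrefix (h : Cond2' R X Y Z u' v p) :
    MEquiv R (X ++ Y ++ u') v ∧ PossPrefix R p (X ++ Y ++ u') := by
  obtain ⟨⟨v', rfl, -, he⟩, hp⟩ := h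
  refine ⟨he.append_left _, ?_⟩
  rcases hp with ⟨t, rfl⟩ | ⟨hp, hZ⟩
  · simpa using possPrefix_append (R := R) p (t ++ Y ++ u')
  · exact hp.possPrefix hZ

theorem Cond3'.mequiv_and_possPrefix (h : Cond3' R X Y Z u' v p) :
    MEquiv R (X ++ Y ++ u') v ∧ PossPrefix R p (X ++ Y ++ u') := by
  obtain ⟨⟨X', Y', Z', u'', v'', rfl, ⟨hcomp, -⟩, rfl, -, Zh, hZh, he⟩, hp⟩ := h
  exact ⟨by simpa using (hZh.mequiv_append he).trans (hcomp.mequiv_append v''),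
    hp.possPrefix (possPrefix_append _ _)⟩

theorem Cond4'.mequiv_and_possPrefix (h : Cond4' R X Y Z u' v p) :
    MEquiv R (X ++ Y ++ u') v ∧ PossPrefix R p (X ++ Y ++ u') := by
  obtain ⟨⟨X', Y', Z', v'', ⟨hcomp, -⟩, rfl, -, -, he⟩, hp⟩ := h
  exact ⟨by simpa using (he.append_left (X ++ Y)).trans (hcomp.mequiv_append v''),
    hp.possPrefix ⟨v'', he.symm⟩⟩

theorem Cond5'.mequiv_and_possPrefix (h : Cond5' R X Y Z u' v p) :
    MEquiv R (X ++ Y ++ u') v ∧ PossPrefix R p (X ++ Y ++ u') := by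
  obtain ⟨⟨X', Y', Z', u'', v', rfl, ⟨hcomp, -⟩, rfl, -, -, he⟩, hp⟩ := h
  exact ⟨(hcomp.mequiv_append u'').trans (he.append_left (X' ++ Y')),
    hp.possPrefix (possPrefix_append _ _)⟩

theorem Cond6'.mequiv_and_possPrefix (h : Cond6' R X Y Z u' v p) :
    MEquiv R (X ++ Y ++ u') v ∧ PossPrefix R p (X ++ Y ++ u') := by
  obtain ⟨⟨X', Y', Z', v', ⟨hcomp, -⟩, rfl, -, -, -, z, z₁, z₂, u'', v'', rfl, rfl, -, rfl,
    rfl, he, -, w, hw⟩, hp⟩ := h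
  have hu : MEquiv R (z₁ ++ z ++ w) (z₁ ++ u'') := by simpa using hw.append_left z₁
  have hv : MEquiv R (z₂ ++ z ++ w) (z₂ ++ v'') := by
    simpa using (hw.trans he).append_left z₂
  exact ⟨((hu.symm.append_left (X ++ Y)).trans (hcomp.mequiv_append w)).trans
    (hv.append_left (X' ++ Y')), hp.possPrefix ⟨w, hu⟩⟩

/-- `v` starts with a proper complement of `r`, up to its maximal piece suffix. -/
def HasProperHead (R : Finset (List A × List A)) (r v : List A) : Prop :=
  ∃ X' Y' Z', ProperComp R r X' Y' Z' ∧ X' ++ Y' <+: v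

/-- `v` starts with a proper complement of `r`. -/
def HasProperPrefix (R : Finset (List A × List A)) (r v : List A) : Prop :=
  ∃ X' Y' Z', ProperComp R r X' Y' Z' ∧ X' ++ Y' ++ Z' <+: v

theorem HasProperPrefix.hasProperHead {r : List A} (h : HasProperPrefix R r v) :
    HasProperHead R r v := by
  obtain ⟨X', Y', Z', h, hpre⟩ := h
  exact ⟨X', Y', Z', h, (List.prefix_append _ _).trans hpre⟩

theorem HasProperHead.not_head (hC : WeaklyC R 4) (hD : RelDecomp R X Y Z)
    (h : HasProperHead R (X ++ Y ++ Z) v) : ¬ X ++ Y <+: v := by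
  intro hpre
  obtain ⟨X', Y', Z', ⟨-, hD', hne⟩, hpre'⟩ := h
  obtain ⟨rfl, rfl, rfl⟩ := hD'.head_unique hC hD hpre' hpre
  exact hne rfl

theorem UniqueComp.not_hasProperPrefix {r X' Y' Z' v' : List A}
    (h : UniqueComp R r (X' ++ Y' ++ v') X' Y' Z') (hn : ¬ Z' <+: v') :
    ¬ HasProperPrefix R r (X' ++ Y' ++ v') := by
  rintro ⟨X'', Y'', Z'', hc, hpre⟩
  obtain ⟨rfl, rfl, rfl⟩ := h _ _ _ hc ((List.prefix_append _ _).trans hpre)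
  exact hn ((List.prefix_append_right_inj _).1 hpre)

theorem Cond1'.profile (h : Cond1' R X Y Z u' v p) : Z <+: u' ∧ X ++ Y ++ Z <+: v := by
  obtain ⟨⟨u'', v'', rfl, rfl, -⟩, -⟩ := h
  exact ⟨List.prefix_append _ _, List.prefix_append _ _⟩

theorem Cond2'.profile (h : Cond2' R X Y Z u' v p) :
    X ++ Y <+: v ∧ ¬ (Z <+: u' ∧ X ++ Y ++ Z <+: v) := by
  obtain ⟨⟨v', rfl, hn, -⟩, -⟩ := h
  refine ⟨List.prefix_append _ _, fun ⟨h₁, h₂⟩ => ?_⟩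
  have := (List.prefix_append_right_inj _).1 h₂
  tauto

theorem Cond3'.profile (h : Cond3' R X Y Z u' v p) :
    Z <+: u' ∧ HasProperPrefix R (X ++ Y ++ Z) v := by
  obtain ⟨⟨X', Y', Z', u'', v'', rfl, hc, rfl, -⟩, -⟩ := h
  exact ⟨List.prefix_append _ _, X', Y', Z', hc, List.prefix_append _ _⟩

theorem Cond4'.profile (h : Cond4' R X Y Z u' v p) :
    ¬ Z <+: u' ∧ HasProperPrefix R (X ++ Y ++ Z) v := by
  obtain ⟨⟨X', Y', Z', v'', hc, rfl, -, hn, -⟩, -⟩ := h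
  exact ⟨hn, X', Y', Z', hc, List.prefix_append _ _⟩

theorem Cond5'.profile (h : Cond5' R X Y Z u' v p) :
    Z <+: u' ∧ HasProperHead R (X ++ Y ++ Z) v ∧ ¬ HasProperPrefix R (X ++ Y ++ Z) v := by
  obtain ⟨⟨X', Y', Z', u'', v', rfl, hc, rfl, huniq, hn, -⟩, -⟩ := h
  exact ⟨List.prefix_append _ _, ⟨X', Y', Z', hc, List.prefix_append _ _⟩,
    huniq.not_hasProperPrefix hn⟩

theorem Cond6'.profile (h : Cond6' R X Y Z u' v p) :
    ¬ Z <+: u' ∧ HasProperHead R (X ++ Y ++ Z) v ∧ ¬ HasProperPrefix R (X ++ Y ++ Z) v := by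
  obtain ⟨⟨X', Y', Z', v', hc, rfl, huniq, hn, hn', -⟩, -⟩ := h
  exact ⟨hn, ⟨X', Y', Z', hc, List.prefix_append _ _⟩, huniq.not_hasProperPrefix hn'⟩

end Conditions

end SmallOverlap

/-- Lemma 14: for a weakly `C(4)` finite monoid presentation, if
`u = X ++ Y ++ u'` with `X ++ Y` a clean overlap prefix of `u`, and `p` is a piece,
then `u ≡ v` and `p` is a possible prefix of `u` if and only if one of the mutually
exclusive conditions (1′)–(6′) holds. -/
theorem lemma_eq_and_prefix {A : Type*} [Fintype A] [DecidableEq A]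
    (R : Finset (List A × List A)) (hC : WeaklyC R 4)
    (u u' X Y Z v p : List A)
    (hu : u = X ++ Y ++ u')
    (hclean : CleanOverlapPrefix R u [] X Y Z)
    (hp : Piece R p) :
    ((MEquiv R u v ∧ PossPrefix R p u) ↔
      (Cond1' R X Y Z u' v p ∨ Cond2' R X Y Z u' v p ∨ Cond3' R X Y Z u' v p ∨
        Cond4' R X Y Z u' v p ∨ Cond5' R X Y Z u' v p ∨ Cond6' R X Y Z u' v p)) ∧
    ¬ (Cond1' R X Y Z u' v p ∧ Cond2' R X Y Z u' v p) ∧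
    ¬ (Cond1' R X Y Z u' v p ∧ Cond3' R X Y Z u' v p) ∧
    ¬ (Cond1' R X Y Z u' v p ∧ Cond4' R X Y Z u' v p) ∧
    ¬ (Cond1' R X Y Z u' v p ∧ Cond5' R X Y Z u' v p) ∧
    ¬ (Cond1' R X Y Z u' v p ∧ Cond6' R X Y Z u' v p) ∧
    ¬ (Cond2' R X Y Z u' v p ∧ Cond3' R X Y Z u' v p) ∧
    ¬ (Cond2' R X Y Z u' v p ∧ Cond4' R X Y Z u' v p) ∧
    ¬ (Cond2' R X Y Z u' v p ∧ Cond5' R X Y Z u' v p) ∧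
    ¬ (Cond2' R X Y Z u' v p ∧ Cond6' R X Y Z u' v p) ∧
    ¬ (Cond3' R X Y Z u' v p ∧ Cond4' R X Y Z u' v p) ∧
    ¬ (Cond3' R X Y Z u' v p ∧ Cond5' R X Y Z u' v p) ∧
    ¬ (Cond3' R X Y Z u' v p ∧ Cond6' R X Y Z u' v p) ∧
    ¬ (Cond4' R X Y Z u' v p ∧ Cond5' R X Y Z u' v p) ∧
    ¬ (Cond4' R X Y Z u' v p ∧ Cond6' R X Y Z u' v p) ∧
    ¬ (Cond5' R X Y Z u' v p ∧ Cond6' R X Y Z u' v p) := by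
  subst hu
  have hD := hclean.1
  have hc := hclean.cleanHead
  refine ⟨⟨fun ⟨h, hpre⟩ => ?_, ?_⟩, ?_⟩
  · obtain ⟨h₁, h₂⟩ := hpre.prefXComp hC hD hc hp
    exact h.conditions hC hD hc h₁ h₂
  · rintro (h | h | h | h | h | h)
    exacts [h.mequiv_and_possPrefix, h.mequiv_and_possPrefix, h.mequiv_and_possPrefix,
      h.mequiv_and_possPrefix, h.mequiv_and_possPrefix, h.mequiv_and_possPrefix]
  · have hT := HasProperPrefix.hasProperHead (R := R) (r := X ++ Y ++ Z) (v := v)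
    have hH := HasProperHead.not_head (v := v) hC hD
    have hXY : X ++ Y ++ Z <+: v → X ++ Y <+: v := (List.prefix_append _ _).trans
    have h₁ := Cond1'.profile (R := R) (X := X) (Y := Y) (Z := Z) (u' := u') (v := v) (p := p)
    have h₂ := Cond2'.profile (R := R) (X := X) (Y := Y) (Z := Z) (u' := u') (v := v) (p := p)
    have h₃ := Cond3'.profile (R := R) (X := X) (Y := Y) (Z := Z) (u' := u') (v := v) (p := p)
    have h₄ := Cond4'.profile (R := R) (X := X) (Y := Y) (Z := Z) (u' := u') (v := v) (p := p)
    have h₅ := Cond5'.profile (R := R) (X := X) (Y := Y) (Z := Z) (u' := u') (v := v) (p := p)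
    have h₆ := Cond6'.profile (R := R) (X := X) (Y := Y) (Z := Z) (u' := u') (v := v) (p := p)
    clear hclean hc hp hD hC
    generalize Cond1' R X Y Z u' v p = C₁ at *
    generalize Cond2' R X Y Z u' v p = C₂ at *
    generalize Cond3' R X Y Z u' v p = C₃ at *
    generalize Cond4' R X Y Z u' v p = C₄ at *
    generalize Cond5' R X Y Z u' v p = C₅ at *
    generalize Cond6' R X Y Z u' v p = C₆ at *
    refine ⟨?_, ?_, ?_, ?_, ?_, ?_, ?_, ?_, ?_, ?_, ?_, ?_, ?_, ?_, ?_⟩ <;>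
      rintro ⟨h, h'⟩ <;> grind
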